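/- (Hardy-type bound for the Morawetz action.) For every dimension n ≥ 2 there exists a constant C = C(n) > 0 such that for every solution u as in the setup, every t ∈ ℝ and every y ∈ ℝⁿ, |M_y(t)| ≤ C ∫_{ℝⁿ} |ξ| |𝓕(u(t,·))(ξ)|² dξ, i.e. |M_y(t)| ≤ C ‖u(t,·)‖²_{Ḣ^{1/2}(ℝⁿ)}. -/

import Mathlib

open MeasureTheory Complex
open scoped FourierTransform

noncomputable section

/-- Euclidean space `ℝⁿ`. -/
abbrev En (n : ℕ) := EuclideanSpace ℝ (Fin n)

/-- Partial derivative `∂_{x_j} f` of a complex-valued function. -/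
noncomputable def pd {n : ℕ} (j : Fin n) (f : En n → ℂ) (x : En n) : ℂ :=
  fderiv ℝ f x (EuclideanSpace.single j 1)

/-- Laplacian `Δf` of a complex-valued function. -/
noncomputable def lap {n : ℕ} (f : En n → ℂ) (x : En n) : ℂ := ∑ j, pd j (pd j f) x

/-- Partial derivative `∂_{x_j} f` of a real-valued function. -/
noncomputable def rpd {n : ℕ} (j : Fin n) (f : En n → ℝ) (x : En n) : ℝ :=
  fderiv ℝ f x (EuclideanSpace.single j 1)

/-- Laplacian `Δf` of a real-valued function. -/
noncomputable def rlap {n : ℕ} (f : En n → ℝ) (x : En n) : ℝ := ∑ j, rpd j (rpd j f) x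

/-- `u : ℝ × ℝⁿ → ℂ` is a smooth solution of the NLS `i∂ₜu + Δu = λ|u|^{p-1}u`,
Schwartz class in `x` locally uniformly in `t`. -/
structure NLSSolution (n : ℕ) (p lam : ℝ) (u : ℝ → En n → ℂ) : Prop where
  smooth : ContDiff ℝ (⊤ : ℕ∞) (fun q : ℝ × En n => u q.1 q.2)
  decay : ∀ (k N : ℕ) (T : ℝ), ∃ C : ℝ, ∀ t : ℝ, |t| ≤ T → ∀ x : En n,
      ‖x‖ ^ N * ‖iteratedFDeriv ℝ k (u t) x‖ ≤ C
  eq : ∀ (t : ℝ) (x : En n),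
      Complex.I * deriv (fun s => u s x) t + lap (u t) x
        = (lam : ℂ) * ((‖u t x‖ ^ (p - 1) : ℝ) : ℂ) * u t x

/-- The momentum density `p_j = Im(ū ∂_{x_j} u)`. -/
noncomputable def mom {n : ℕ} (u : ℝ → En n → ℂ) (j : Fin n) (t : ℝ) (x : En n) : ℝ :=
  (starRingEnd ℂ (u t x) * pd j (u t) x).im

/-- The Morawetz action centered at `y`:
`M_y(t) = ∫ ((x-y)/|x-y|) · Im(ū ∇u)(t,x) dx`. -/
noncomputable def morAction {n : ℕ} (u : ℝ → En n → ℂ) (y : En n) (t : ℝ) : ℝ :=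
  ∫ x : En n, ∑ j, ((x j - y j) / ‖x - y‖) * mom u j t x


/-- The truncated kernel. -/
def kk {n : ℕ} (r : ℝ) (h : En n) : ℝ := (min 1 (r * ‖h‖)) ^ 2 * ‖h‖⁻¹ ^ (n + 1)

lemma kk_nonneg {n : ℕ} (r : ℝ) (h : En n) : 0 ≤ kk r h := by unfold kk; positivity

@[fun_prop]
lemma kk_meas {n : ℕ} (r : ℝ) : Measurable (fun h : En n => kk r h) := by
  unfold kk; fun_prop

/-- Mass of the kernel. -/
def JJ (n : ℕ) : ENNReal := ∫⁻ h : En n, ENNReal.ofReal (kk 1 h)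

lemma JJ_lt_top (n : ℕ) (hn : 2 ≤ n) : JJ n < ⊤ := by
  have : Nontrivial (En n) := by
    have : Nonempty (Fin n) := ⟨⟨0, by omega⟩⟩
    infer_instance
  have key : Integrable (fun h : En n => kk 1 h) := by
    have := (integrable_fun_norm_addHaar (E := En n) volume
      (f := fun y : ℝ => (min 1 (1 * y)) ^ 2 * y⁻¹ ^ (n + 1))).2 ?_
    · exact this
    · have h1 : IntegrableOn (fun y : ℝ => (1:ℝ)) (Set.Ioc 0 1) := by simp
      have h2 : IntegrableOn (fun y : ℝ => y ^ (-2 : ℝ)) (Set.Ioi 1) :=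
        integrableOn_Ioi_rpow_of_lt (by norm_num) (by norm_num)
      rw [← Set.Ioc_union_Ioi_eq_Ioi (zero_le_one (α := ℝ))]
      refine IntegrableOn.union ?_ ?_
      · refine h1.congr_fun ?_ measurableSet_Ioc
        intro y hy
        have hy0 : y ≠ 0 := hy.1.ne'
        simp only [finrank_euclideanSpace, Fintype.card_fin, smul_eq_mul, one_mul]
        rw [min_eq_right hy.2]
        obtain ⟨m, rfl⟩ : ∃ m, n = m + 1 := ⟨n - 1, by omega⟩
        simp only [Nat.add_sub_cancel]
        rw [inv_pow]; field_simp; ring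
      · refine h2.congr_fun ?_ measurableSet_Ioi
        intro y hy
        have hy1 : (1:ℝ) < y := hy
        have hy0 : y ≠ 0 := by positivity
        simp only [finrank_euclideanSpace, Fintype.card_fin, smul_eq_mul, one_mul]
        rw [min_eq_left hy1.le, Real.rpow_neg (by positivity)]
        obtain ⟨m, rfl⟩ : ∃ m, n = m + 1 := ⟨n - 1, by omega⟩
        simp only [Nat.add_sub_cancel]
        rw [inv_pow]
        norm_cast
        field_simp; simp; ring
  have := key.2
  rw [hasFiniteIntegral_iff_ofReal (.of_forall fun h => kk_nonneg 1 h)] at this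
  exact this

lemma JJ_scale (n : ℕ) {r : ℝ} (hr : 0 < r) :
    ∫⁻ h : En n, ENNReal.ofReal (kk r h) = ENNReal.ofReal r * JJ n := by
  have hmap := Measure.map_addHaar_smul (volume : Measure (En n)) hr.ne'
  have h1 : ∫⁻ h : En n, ENNReal.ofReal (kk 1 (r • h))
      = ENNReal.ofReal (|(r ^ n)⁻¹|) * JJ n := by
    have := lintegral_map (μ := (volume : Measure (En n)))
      (f := fun h => ENNReal.ofReal (kk 1 h)) (g := fun h : En n => r • h)
      (by fun_prop) (by fun_prop)
    rw [hmap, lintegral_smul_measure] at this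
    simp only [finrank_euclideanSpace, Fintype.card_fin] at this
    rw [← this]; rfl
  have h2 : ∀ h : En n, kk r h = r ^ (n + 1) * kk 1 (r • h) := by
    intro h
    unfold kk
    rw [norm_smul, Real.norm_of_nonneg hr.le, mul_inv, mul_pow r⁻¹, one_mul, inv_pow r]
    field_simp
  simp_rw [h2, ENNReal.ofReal_mul (pow_nonneg hr.le (n+1))]
  rw [lintegral_const_mul _ (by fun_prop), h1, ← mul_assoc, ← ENNReal.ofReal_mul (by positivity)]
  congr 2
  rw [abs_of_pos (by positivity)]
  field_simp
  ring

/-- Gagliardo seminorm (squared). -/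
def GG {n : ℕ} (f : En n → ℂ) : ENNReal :=
  ∫⁻ x : En n, ∫⁻ h : En n, ENNReal.ofReal (‖f (x + h) - f x‖ ^ 2 * ‖h‖⁻¹ ^ (n + 1))

/-- Hardy weight integral. -/
def HH {n : ℕ} (f : En n → ℂ) : ENNReal :=
  ∫⁻ x : En n, ENNReal.ofReal (‖f x‖ ^ 2 * ‖x‖⁻¹)

lemma two_mul_ofReal' (a : ℝ) : 2 * ENNReal.ofReal a = ENNReal.ofReal (2 * a) := by
  rw [ENNReal.ofReal_mul (by norm_num)]; simp

lemma nontriv_En {n : ℕ} (hn : 2 ≤ n) : Nontrivial (En n) := by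
  have : Nonempty (Fin n) := ⟨⟨0, by omega⟩⟩
  infer_instance

lemma ae_ne_zero {n : ℕ} (hn : 2 ≤ n) : ∀ᵐ x : En n, x ≠ 0 := by
  have := nontriv_En hn
  exact compl_mem_ae_iff.2 (measure_singleton 0)

lemma sq_norm_add_le (a b : ℂ) : ‖a + b‖ ^ 2 ≤ 2 * ‖a‖ ^ 2 + 2 * ‖b‖ ^ 2 := by
  have := norm_add_le a b
  nlinarith [sq_nonneg (‖a‖ - ‖b‖), norm_nonneg (a + b), norm_nonneg a, norm_nonneg b]

lemma GG_prod {n : ℕ} (hn : 2 ≤ n) (f : En n → ℂ) (hf : Continuous f) (b : En n → ℝ)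
    (hb1 : ∀ x, |b x| ≤ 1)
    (hb2 : ∀ x h, x ≠ 0 → |b (x + h) - b x| ≤ 2 * min 1 (‖x‖⁻¹ * ‖h‖)) :
    GG (fun x => (b x : ℂ) * f x) ≤ 2 * GG f + 8 * JJ n * HH f := by
  have hfm : Measurable f := hf.measurable
  have pt : ∀ x : En n, x ≠ 0 →
      ∫⁻ h : En n, ENNReal.ofReal (‖(b (x + h) : ℂ) * f (x + h) - (b x : ℂ) * f x‖ ^ 2
        * ‖h‖⁻¹ ^ (n + 1)) ≤
      2 * (∫⁻ h : En n, ENNReal.ofReal (‖f (x + h) - f x‖ ^ 2 * ‖h‖⁻¹ ^ (n + 1)))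
       + 8 * JJ n * ENNReal.ofReal (‖f x‖ ^ 2 * ‖x‖⁻¹) := by
    intro x hx
    have hx' : 0 < ‖x‖⁻¹ := by positivity
    calc _ ≤ ∫⁻ h : En n, (2 * ENNReal.ofReal (‖f (x + h) - f x‖ ^ 2 * ‖h‖⁻¹ ^ (n + 1))
            + ENNReal.ofReal (8 * ‖f x‖ ^ 2) * ENNReal.ofReal (kk ‖x‖⁻¹ h)) := by
          apply lintegral_mono
          intro h
          dsimp only
          rw [two_mul_ofReal',
            ← ENNReal.ofReal_mul (by positivity), ← ENNReal.ofReal_add (by positivity)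
              (mul_nonneg (by positivity) (kk_nonneg _ _))]
          apply ENNReal.ofReal_le_ofReal
          unfold kk
          have hw : 0 ≤ ‖h‖⁻¹ ^ (n + 1) := by positivity
          have e1 : (b (x + h) : ℂ) * f (x + h) - (b x : ℂ) * f x
              = (b (x + h) : ℂ) * (f (x + h) - f x) + ((b (x + h) - b x : ℝ) : ℂ) * f x := by
            push_cast; ring
          have e2 := sq_norm_add_le ((b (x + h) : ℂ) * (f (x + h) - f x))
            (((b (x + h) - b x : ℝ) : ℂ) * f x)
          rw [← e1, norm_mul, norm_mul, Complex.norm_real, Complex.norm_real, Real.norm_eq_abs,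
            Real.norm_eq_abs, mul_pow, mul_pow] at e2
          have e3 : |b (x + h)| ^ 2 ≤ 1 := pow_le_one₀ (abs_nonneg _) (hb1 _)
          have e4 : |b (x + h) - b x| ^ 2 ≤ (2 * min 1 (‖x‖⁻¹ * ‖h‖)) ^ 2 :=
            pow_le_pow_left₀ (abs_nonneg _) (hb2 x h hx) 2
          have e5 := mul_le_mul_of_nonneg_right e3 (sq_nonneg ‖f (x + h) - f x‖)
          have e6 := mul_le_mul_of_nonneg_right e4 (sq_nonneg ‖f x‖)
          calc _ ≤ (2 * ‖f (x + h) - f x‖ ^ 2 + 8 * ‖f x‖ ^ 2 * (min 1 (‖x‖⁻¹ * ‖h‖)) ^ 2)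
                * ‖h‖⁻¹ ^ (n + 1) := by
                apply mul_le_mul_of_nonneg_right _ hw
                nlinarith
            _ = _ := by ring
      _ = _ := by
          rw [lintegral_add_left (by fun_prop), lintegral_const_mul _ (by fun_prop),
            lintegral_const_mul _ (by fun_prop), JJ_scale n hx',
            ENNReal.ofReal_mul (by norm_num), ENNReal.ofReal_mul (by positivity)]
          simp only [ENNReal.ofReal_ofNat]
          ring
  calc GG (fun x => (b x : ℂ) * f x) ≤ ∫⁻ x : En n, (2 * (∫⁻ h : En n,
        ENNReal.ofReal (‖f (x + h) - f x‖ ^ 2 * ‖h‖⁻¹ ^ (n + 1)))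
       + 8 * JJ n * ENNReal.ofReal (‖f x‖ ^ 2 * ‖x‖⁻¹)) := by
        apply lintegral_mono_ae
        filter_upwards [ae_ne_zero hn] with x hx using pt x hx
    _ = _ := by
        rw [lintegral_add_right _ (by fun_prop), lintegral_const_mul _ ?_,
          lintegral_const_mul _ (by fun_prop)]
        · rfl
        · apply Measurable.lintegral_prod_right'
            (f := fun p : En n × En n => ENNReal.ofReal (‖f (p.1 + p.2) - f p.1‖ ^ 2
              * ‖p.2‖⁻¹ ^ (n + 1)))
          fun_prop

lemma HH_lt_top {n : ℕ} (hn : 2 ≤ n) (f : SchwartzMap (En n) ℂ) : HH f < ⊤ := by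
  have hfm : Measurable f := f.continuous.measurable
  obtain ⟨B, hB0, hB⟩ : ∃ B : ℝ, 0 ≤ B ∧ ∀ x, ‖f x‖ ≤ B := by
    obtain ⟨B, hB⟩ := f.decay 0 0
    exact ⟨B, hB.1.le, fun x => by simpa using hB.2 x⟩
  have hint : ∫⁻ x : En n, ENNReal.ofReal (B * ‖f x‖) < ⊤ := by
    have := (f.integrable (μ := volume)).norm.const_mul B
    have h2 := this.2
    rwa [hasFiniteIntegral_iff_ofReal (.of_forall fun x => by positivity)] at h2
  calc HH f ≤ ∫⁻ x : En n, (ENNReal.ofReal (B ^ 2) * ENNReal.ofReal (kk 1 x)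
          + ENNReal.ofReal (B * ‖f x‖)) := by
        apply lintegral_mono
        intro x
        dsimp only
        rw [← ENNReal.ofReal_mul (by positivity), ← ENNReal.ofReal_add
          (mul_nonneg (by positivity) (kk_nonneg _ _)) (by positivity)]
        apply ENNReal.ofReal_le_ofReal
        have h1 : ‖f x‖ ^ 2 ≤ B ^ 2 := pow_le_pow_left₀ (norm_nonneg _) (hB x) 2
        have h2 : ‖f x‖ ^ 2 ≤ B * ‖f x‖ := by nlinarith [hB x, norm_nonneg (f x)]
        rcases eq_or_ne x 0 with rfl | hx
        · simp [kk]; positivity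
        have hx0 : 0 < ‖x‖ := by positivity
        rcases le_total 1 ‖x‖ with h | h
        · have h3 : ‖x‖⁻¹ ≤ 1 := inv_le_one_of_one_le₀ h
          have h4 : ‖f x‖ ^ 2 * ‖x‖⁻¹ ≤ ‖f x‖ ^ 2 * 1 :=
            mul_le_mul_of_nonneg_left h3 (by positivity)
          have := mul_nonneg (sq_nonneg B) (kk_nonneg 1 x)
          linarith
        · have h3 : ‖x‖⁻¹ ≤ kk 1 x := by
            unfold kk
            rw [one_mul, min_eq_right h]
            have h5 : 1 ≤ ‖x‖⁻¹ := (one_le_inv₀ hx0).2 h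
            obtain ⟨m, rfl⟩ : ∃ m, n = m + 2 := ⟨n - 2, by omega⟩
            have h6 : ‖x‖ ^ 2 * ‖x‖⁻¹ ^ (m + 2 + 1) = ‖x‖⁻¹ * ‖x‖⁻¹ ^ m := by
              rw [inv_pow, inv_pow]; field_simp; ring
            rw [h6]
            have := one_le_pow₀ h5 (n := m)
            nlinarith
          have h4 := mul_le_mul h1 h3 (by positivity) (by positivity)
          have : 0 ≤ B * ‖f x‖ := by positivity
          linarith
    _ = ENNReal.ofReal (B ^ 2) * JJ n + ∫⁻ x : En n, ENNReal.ofReal (B * ‖f x‖) := by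
        rw [lintegral_add_left (by fun_prop), lintegral_const_mul _ (by fun_prop)]; rfl
    _ < ⊤ := by
        refine ENNReal.add_lt_top.2 ⟨ENNReal.mul_lt_top ENNReal.ofReal_lt_top (JJ_lt_top n hn), hint⟩

lemma hardy_pre {n : ℕ} (hn : 2 ≤ n) (f : En n → ℂ) (hf : Continuous f) {A : ℝ} (hA : 1 ≤ A) :
    ENNReal.ofReal (A ^ n) * volume (Metric.closedBall (0 : En n) 1) * HH f
      ≤ ENNReal.ofReal (2 * (A + 1) ^ (n + 1)) * GG f + 2 * ENNReal.ofReal A * JJ n * HH f := by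
  have hfm : Measurable f := hf.measurable
  have pt : ∀ x : En n, x ≠ 0 →
      ENNReal.ofReal (A ^ n) * volume (Metric.closedBall (0 : En n) 1)
        * ENNReal.ofReal (‖f x‖ ^ 2 * ‖x‖⁻¹) ≤
      ENNReal.ofReal (2 * (A + 1) ^ (n + 1)) *
        (∫⁻ h : En n, ENNReal.ofReal (‖f (x + h) - f x‖ ^ 2 * ‖h‖⁻¹ ^ (n + 1)))
       + 2 * ∫⁻ z : En n, ENNReal.ofReal (‖f z‖ ^ 2 * kk (A * ‖z‖⁻¹) x) := by
    intro x hx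
    have hx0 : 0 < ‖x‖ := by positivity
    have hvol := Measure.addHaar_closedBall (volume : Measure (En n)) 0
      (r := A * ‖x‖) (by positivity)
    have hvol1 := Measure.addHaar_closedBall (volume : Measure (En n)) 0
      (r := 1) (by positivity)
    simp only [finrank_euclideanSpace, Fintype.card_fin, one_pow, ENNReal.ofReal_one, one_mul]
      at hvol hvol1
    calc _ = ∫⁻ z : En n, (Metric.closedBall (0 : En n) (A * ‖x‖)).indicator
              (fun _ => ENNReal.ofReal (‖f x‖ ^ 2 * ‖x‖⁻¹ ^ (n + 1))) z := by
          rw [lintegral_indicator measurableSet_closedBall, setLIntegral_const, hvol, hvol1,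
            ← mul_assoc, mul_right_comm, ← ENNReal.ofReal_mul (by positivity),
            ← ENNReal.ofReal_mul (by positivity)]
          congr 2
          rw [inv_pow]
          field_simp
          ring
      _ ≤ ∫⁻ z : En n, (ENNReal.ofReal (2 * (A + 1) ^ (n + 1)) *
            ENNReal.ofReal (‖f (x + (-x + z)) - f x‖ ^ 2 * ‖-x + z‖⁻¹ ^ (n + 1))
            + 2 * ENNReal.ofReal (‖f z‖ ^ 2 * kk (A * ‖z‖⁻¹) x)) := by
          apply lintegral_mono_ae
          filter_upwards [ae_ne_zero hn] with z hz
          by_cases hzx : z ∈ Metric.closedBall (0 : En n) (A * ‖x‖)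
          swap
          · simp [hzx]
          rw [Set.indicator_of_mem hzx]
          rw [mem_closedBall_zero_iff] at hzx
          have hz0 : 0 < ‖z‖ := by positivity
          rw [two_mul_ofReal', ← ENNReal.ofReal_mul (by positivity), ← ENNReal.ofReal_add (by positivity)
              (mul_nonneg (by positivity) (mul_nonneg (by positivity) (kk_nonneg _ _)))]
          apply ENNReal.ofReal_le_ofReal
          have hk : kk (A * ‖z‖⁻¹) x = ‖x‖⁻¹ ^ (n + 1) := by
            unfold kk
            rw [min_eq_left]
            · simp
            · rw [mul_right_comm, ← div_eq_mul_inv, one_le_div hz0]; exact hzx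
          rw [hk, add_neg_cancel_left]
          have e1 := sq_norm_add_le (-(f z - f x)) (f z)
          rw [norm_neg, neg_sub, sub_add_cancel] at e1
          have hw : 0 ≤ ‖x‖⁻¹ ^ (n + 1) := by positivity
          have e2 := mul_le_mul_of_nonneg_right e1 hw
          have e3 : ‖f z - f x‖ ^ 2 * ‖x‖⁻¹ ^ (n + 1)
              ≤ ‖f z - f x‖ ^ 2 * ((A + 1) ^ (n + 1) * ‖-x + z‖⁻¹ ^ (n + 1)) := by
            rcases eq_or_ne z x with rfl | hne
            · simp
            apply mul_le_mul_of_nonneg_left _ (by positivity)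
            rw [← mul_pow]
            apply pow_le_pow_left₀ (by positivity)
            have hne' : 0 < ‖-x + z‖ := by
              rw [norm_pos_iff, neg_add_eq_sub]; exact sub_ne_zero.2 hne
            rw [← div_eq_mul_inv, inv_eq_one_div, div_le_div_iff₀ hx0 hne', one_mul]
            have := norm_add_le (-x) z
            rw [norm_neg] at this
            nlinarith
          nlinarith
      _ = _ := by
          rw [lintegral_add_left (by fun_prop), lintegral_const_mul _ (by fun_prop),
            lintegral_const_mul _ (by unfold kk; fun_prop)]
          congr 2
          exact lintegral_add_left_eq_self (fun h => ENNReal.ofReal (‖f (x + h) - f x‖ ^ 2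
            * ‖h‖⁻¹ ^ (n + 1))) (-x)
  have hG : Measurable fun x : En n => ∫⁻ h : En n,
      ENNReal.ofReal (‖f (x + h) - f x‖ ^ 2 * ‖h‖⁻¹ ^ (n + 1)) := by
    apply Measurable.lintegral_prod_right'
            (f := fun p : En n × En n => ENNReal.ofReal (‖f (p.1 + p.2) - f p.1‖ ^ 2
              * ‖p.2‖⁻¹ ^ (n + 1)))
    fun_prop
  have hswap : ∫⁻ x : En n, ∫⁻ z : En n, ENNReal.ofReal (‖f z‖ ^ 2 * kk (A * ‖z‖⁻¹) x)
      = ENNReal.ofReal A * JJ n * HH f := by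
    rw [lintegral_lintegral_swap (by unfold kk; fun_prop)]
    unfold HH
    rw [← lintegral_const_mul _ (by fun_prop)]
    apply lintegral_congr_ae
    filter_upwards [ae_ne_zero hn] with z hz
    have hz0 : 0 < ‖z‖ := by positivity
    simp_rw [ENNReal.ofReal_mul (sq_nonneg ‖f z‖)]
    rw [lintegral_const_mul _ (by fun_prop), JJ_scale n (by positivity),
      ENNReal.ofReal_mul (by positivity)]
    ring
  unfold HH
  rw [← lintegral_const_mul _ (by fun_prop)]
  calc _ ≤ ∫⁻ x : En n, (ENNReal.ofReal (2 * (A + 1) ^ (n + 1)) *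
        (∫⁻ h : En n, ENNReal.ofReal (‖f (x + h) - f x‖ ^ 2 * ‖h‖⁻¹ ^ (n + 1)))
       + 2 * ∫⁻ z : En n, ENNReal.ofReal (‖f z‖ ^ 2 * kk (A * ‖z‖⁻¹) x)) := by
        apply lintegral_mono_ae
        filter_upwards [ae_ne_zero hn] with x hx using pt x hx
    _ = _ := by
        rw [lintegral_add_left (hG.const_mul _), lintegral_const_mul _ hG,
          lintegral_const_mul' _ _ (by simp), hswap, ← mul_assoc, ← mul_assoc]
        rfl

lemma hardy {n : ℕ} (hn : 2 ≤ n) :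
    ∃ C : ENNReal, C ≠ ⊤ ∧ ∀ f : SchwartzMap (En n) ℂ, HH f ≤ C * GG f := by
  set v := volume (Metric.closedBall (0 : En n) 1) with hv
  have hv0 : 0 < v := Metric.measure_closedBall_pos volume 0 one_pos
  have hvt : v ≠ ⊤ := measure_closedBall_lt_top.ne
  have hJ := (JJ_lt_top n hn).ne
  have hv' : 0 < v.toReal := ENNReal.toReal_pos hv0.ne' hvt
  have hJ' : 0 ≤ (JJ n).toReal := ENNReal.toReal_nonneg
  obtain ⟨A, hA1, hA2⟩ : ∃ A : ℝ, 1 ≤ A ∧ 4 * (JJ n).toReal / v.toReal ≤ A :=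
    ⟨_, le_max_left _ _, le_max_right _ _⟩
  have hA3 : 2 * (2 * ENNReal.ofReal A * JJ n) ≤ ENNReal.ofReal (A ^ n) * v := by
    rw [← ENNReal.ofReal_toReal hJ, ← ENNReal.ofReal_toReal hvt,
      show (2 : ENNReal) = ENNReal.ofReal 2 by simp, ← ENNReal.ofReal_mul (by positivity),
      ← ENNReal.ofReal_mul (by positivity), ← ENNReal.ofReal_mul (by positivity),
      ← ENNReal.ofReal_mul (by positivity)]
    apply ENNReal.ofReal_le_ofReal
    rw [div_le_iff₀ hv'] at hA2
    have h2 : A ^ 2 ≤ A ^ n := pow_le_pow_right₀ hA1 hn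
    have h3 : A ^ 2 * v.toReal ≤ A ^ n * v.toReal := mul_le_mul_of_nonneg_right h2 hv'.le
    nlinarith
  set c := ENNReal.ofReal (A ^ n) * v with hc
  have hc0 : c ≠ 0 := by
    apply mul_ne_zero _ hv0.ne'
    rw [Ne, ENNReal.ofReal_eq_zero, not_le]; positivity
  have hct : c ≠ ⊤ := ENNReal.mul_ne_top ENNReal.ofReal_ne_top hvt
  refine ⟨c⁻¹ * (2 * ENNReal.ofReal (2 * (A + 1) ^ (n + 1))), ?_, ?_⟩
  · exact ENNReal.mul_ne_top (ENNReal.inv_ne_top.2 hc0)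
      (ENNReal.mul_ne_top (by simp) ENNReal.ofReal_ne_top)
  intro f
  have hH := (HH_lt_top hn f).ne
  have h1 := hardy_pre hn f f.continuous hA1
  rw [← hv, ← hc] at h1
  set Y := ENNReal.ofReal (2 * (A + 1) ^ (n + 1)) * GG f with hY
  set X := HH f with hX
  have h2 : c * X + c * X ≤ 2 * Y + c * X := by
    calc c * X + c * X = 2 * (c * X) := by ring
      _ ≤ 2 * (Y + 2 * ENNReal.ofReal A * JJ n * X) := by gcongr
      _ = 2 * Y + (2 * (2 * ENNReal.ofReal A * JJ n)) * X := by ring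
      _ ≤ _ := by gcongr
  have h3 : c * X ≤ 2 * Y := (ENNReal.add_le_add_iff_right (ENNReal.mul_ne_top hct hH)).1 h2
  calc X = c⁻¹ * (c * X) := by rw [← mul_assoc, ENNReal.inv_mul_cancel hc0 hct, one_mul]
    _ ≤ c⁻¹ * (2 * Y) := by gcongr
    _ = _ := by rw [hY]; ring

open scoped RealInnerProductSpace in
lemma fourier_shift {n : ℕ} (f : En n → ℂ) (h ξ : En n) :
    𝓕 (fun x => f (x + h)) ξ = ((Real.fourierChar (inner ℝ h ξ) : Circle) : ℂ) * 𝓕 f ξ := by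
  have := congrFun (VectorFourier.fourierIntegral_comp_add_right Real.fourierChar
    (volume : Measure (En n)) (innerₗ (En n)) f h) ξ
  simpa [Circle.smul_def] using! this

lemma schwartz_sq_integrable {n : ℕ} (f : SchwartzMap (En n) ℂ) :
    Integrable (fun x => ‖f x‖ ^ 2) := by
  simpa using (f.memLp 2 volume).integrable_norm_pow (by norm_num)

lemma plancherel_shift {n : ℕ} (f : SchwartzMap (En n) ℂ) (h : En n) :
    ∫⁻ x, ENNReal.ofReal (‖f (x + h) - f x‖ ^ 2)
      = ∫⁻ ξ, ENNReal.ofReal (‖((Real.fourierChar (inner ℝ h ξ) : Circle) : ℂ) - 1‖ ^ 2)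
          * ENNReal.ofReal (‖𝓕 (f : En n → ℂ) ξ‖ ^ 2) := by
  set d : SchwartzMap (En n) ℂ := f.compSubConstCLM ℂ (-h) - f with hd
  have h1 : ∀ x, d x = f (x + h) - f x := by intro x; simp [hd]
  have h2 : ∀ ξ, 𝓕 d ξ = (((Real.fourierChar (inner ℝ h ξ) : Circle) : ℂ) - 1)
      * 𝓕 (f : En n → ℂ) ξ := by
    intro ξ
    rw [sub_mul, one_mul, ← fourier_shift]
    rw [hd, ← FourierTransform.fourierCLM_apply (R := ℂ), map_sub,
      FourierTransform.fourierCLM_apply, FourierTransform.fourierCLM_apply, SchwartzMap.sub_apply, SchwartzMap.fourier_coe,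
      SchwartzMap.fourier_coe]
    have e : (f.compSubConstCLM ℂ (-h) : En n → ℂ) = fun x => f (x + h) := by
      ext x; simp
    rw [e]
  have h3 := SchwartzMap.integral_norm_sq_fourier d
  have h4 := congrArg ENNReal.ofReal h3
  rw [ofReal_integral_eq_lintegral_ofReal (schwartz_sq_integrable _)
      (.of_forall fun x => by positivity),
    ofReal_integral_eq_lintegral_ofReal (schwartz_sq_integrable _)
      (.of_forall fun x => by positivity)] at h4
  simp_rw [h1, h2, norm_mul, mul_pow] at h4
  rw [← h4]
  apply lintegral_congr
  intro ξ
  rw [ENNReal.ofReal_mul (by positivity)]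

/-- Symbol of the Gagliardo form. -/
def cc {n : ℕ} (ξ : En n) : ENNReal :=
  ∫⁻ h : En n, ENNReal.ofReal (‖((Real.fourierChar (inner ℝ h ξ) : Circle) : ℂ) - 1‖ ^ 2
    * ‖h‖⁻¹ ^ (n + 1))

lemma GG_fourier {n : ℕ} (f : SchwartzMap (En n) ℂ) :
    GG f = ∫⁻ ξ, cc ξ * ENNReal.ofReal (‖𝓕 (f : En n → ℂ) ξ‖ ^ 2) := by
  have hfm : Measurable f := f.continuous.measurable
  have hFm : Measurable (𝓕 (f : En n → ℂ)) := by
    rw [← SchwartzMap.fourier_coe]; exact (𝓕 f).continuous.measurable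
  have hem : Continuous (fun p : En n × En n =>
      ((Real.fourierChar (inner ℝ p.1 p.2) : Circle) : ℂ)) := by
    have := Real.continuous_fourierChar
    fun_prop
  have hem1 := hem.measurable
  have hem2 : ∀ ξ : En n, Measurable (fun h : En n =>
      ((Real.fourierChar (inner ℝ h ξ) : Circle) : ℂ)) := fun ξ =>
    (hem.comp (by fun_prop : Continuous fun h : En n => (h, ξ))).measurable
  have hem3 : ∀ h : En n, Measurable (fun ξ : En n =>
      ((Real.fourierChar (inner ℝ h ξ) : Circle) : ℂ)) := fun h =>
    (hem.comp (by fun_prop : Continuous fun ξ : En n => (h, ξ))).measurable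
  unfold GG
  rw [lintegral_lintegral_swap (by fun_prop)]
  have : ∀ h : En n, ∫⁻ x, ENNReal.ofReal (‖f (x + h) - f x‖ ^ 2 * ‖h‖⁻¹ ^ (n + 1))
      = ∫⁻ ξ, ENNReal.ofReal (‖((Real.fourierChar (inner ℝ h ξ) : Circle) : ℂ) - 1‖ ^ 2
    * ‖h‖⁻¹ ^ (n + 1)) * ENNReal.ofReal (‖𝓕 (f : En n → ℂ) ξ‖ ^ 2) := by
    intro h
    simp_rw [ENNReal.ofReal_mul (sq_nonneg _)]
    rw [lintegral_mul_const _ (by fun_prop), plancherel_shift, ← lintegral_mul_const _ ?_]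
    · apply lintegral_congr; intro ξ; ring
    · have := hem3 h
      fun_prop
  simp_rw [this]
  rw [lintegral_lintegral_swap]
  · apply lintegral_congr
    intro ξ
    have := hem2 ξ
    rw [lintegral_mul_const _ (by fun_prop)]
    rfl
  · apply Measurable.aemeasurable
    unfold Function.uncurry
    dsimp only
    fun_prop

lemma norm_char_sub_one (t : ℝ) :
    ‖((Real.fourierChar t : Circle) : ℂ) - 1‖ = 2 * |Real.sin (Real.pi * t)| := by
  have := Complex.norm_exp_I_mul_ofReal_sub_one (2 * Real.pi * t)
  rw [Real.fourierChar_apply, mul_comm (_ : ℂ) Complex.I, this, norm_mul]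
  simp only [Real.norm_eq_abs, Nat.abs_ofNat]
  congr 3
  ring

lemma cc_le {n : ℕ} {ξ : En n} (hξ : ξ ≠ 0) :
    cc ξ ≤ 4 * ENNReal.ofReal Real.pi * JJ n * ENNReal.ofReal ‖ξ‖ := by
  have hξ0 : 0 < ‖ξ‖ := by positivity
  have hpi := Real.pi_pos
  calc cc ξ ≤ ∫⁻ h : En n, ENNReal.ofReal 4 * ENNReal.ofReal (kk (Real.pi * ‖ξ‖) h) := by
        apply lintegral_mono
        intro h
        dsimp only
        rw [← ENNReal.ofReal_mul (by norm_num)]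
        apply ENNReal.ofReal_le_ofReal
        unfold kk
        rw [norm_char_sub_one, ← mul_assoc]
        apply mul_le_mul_of_nonneg_right _ (by positivity)
        have h1 : |Real.sin (Real.pi * inner ℝ h ξ)| ≤ min 1 (Real.pi * ‖ξ‖ * ‖h‖) := by
          apply le_min (Real.abs_sin_le_one _)
          refine (Real.abs_sin_le_abs).trans ?_
          rw [abs_mul, abs_of_pos hpi, mul_assoc]
          apply mul_le_mul_of_nonneg_left _ hpi.le
          rw [mul_comm]
          exact abs_real_inner_le_norm h ξ
        have h2 := pow_le_pow_left₀ (abs_nonneg _) h1 2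
        rw [mul_pow]
        linarith
    _ = _ := by
        rw [lintegral_const_mul _ (by fun_prop), JJ_scale n (by positivity),
          ENNReal.ofReal_mul hpi.le]
        simp only [ENNReal.ofReal_ofNat]
        ring

lemma le_cc {n : ℕ} {ξ : En n} (hξ : ξ ≠ 0) :
    ENNReal.ofReal ((1 / 4) ^ n) * volume (Metric.ball (0 : En n) 1) * ENNReal.ofReal ‖ξ‖
      ≤ cc ξ := by
  have hξ0 : 0 < ‖ξ‖ := by positivity
  have hpi := Real.pi_pos
  set c : En n := (1 / (2 * ‖ξ‖ ^ 2)) • ξ with hc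
  set B := Metric.closedBall c (1 / (4 * ‖ξ‖)) with hB
  have hvol := Measure.addHaar_closedBall (volume : Measure (En n)) c
      (r := 1 / (4 * ‖ξ‖)) (by positivity)
  simp only [finrank_euclideanSpace, Fintype.card_fin] at hvol
  calc _ = ∫⁻ h : En n, B.indicator (fun _ => ENNReal.ofReal (‖ξ‖ ^ (n + 1))) h := by
        rw [lintegral_indicator measurableSet_closedBall, setLIntegral_const, hvol,
          ← mul_assoc, mul_right_comm, ← ENNReal.ofReal_mul (by positivity),
            ← ENNReal.ofReal_mul (by positivity)]
        congr 2
        rw [div_pow, div_pow, mul_pow]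
        field_simp
        ring
    _ ≤ cc ξ := by
        apply lintegral_mono
        intro h
        by_cases hh : h ∈ B
        swap
        · simp [hh]
        rw [Set.indicator_of_mem hh]
        apply ENNReal.ofReal_le_ofReal
        rw [hB, mem_closedBall_iff_norm] at hh
        have i1 : inner ℝ h ξ = 1 / 2 + inner ℝ (h - c) ξ := by
          rw [inner_sub_left, hc, inner_smul_left, real_inner_self_eq_norm_sq]
          simp only [conj_trivial]
          field_simp
          ring
        have i2 : |inner ℝ (h - c) ξ| ≤ 1 / 4 := by
          refine (abs_real_inner_le_norm _ _).trans ?_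
          calc _ ≤ 1 / (4 * ‖ξ‖) * ‖ξ‖ := mul_le_mul_of_nonneg_right hh hξ0.le
            _ = _ := by field_simp
        rw [abs_le] at i2
        have hcn : ‖c‖ = 1 / (2 * ‖ξ‖) := by
          rw [hc, norm_smul, Real.norm_of_nonneg (by positivity)]
          field_simp
        have i3 : ‖h‖ ≤ 1 / ‖ξ‖ := by
          have := norm_add_le (h - c) c
          rw [sub_add_cancel, hcn] at this
          have e : 1 / (4 * ‖ξ‖) + 1 / (2 * ‖ξ‖) ≤ 1 / ‖ξ‖ := by
            rw [show 1 / (4 * ‖ξ‖) + 1 / (2 * ‖ξ‖) = (3 / 4) * (1 / ‖ξ‖) by field_simp; norm_num]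
            have : 0 < 1 / ‖ξ‖ := by positivity
            linarith
          linarith
        have i4 : 0 < ‖h‖ := by
          rw [norm_pos_iff]
          rintro rfl
          rw [inner_zero_left] at i1
          linarith
        have i5 : ‖ξ‖ ≤ ‖h‖⁻¹ := by
          rw [le_inv_comm₀ hξ0 i4, inv_eq_one_div]; exact i3
        have i6 : ‖ξ‖ ^ (n + 1) ≤ ‖h‖⁻¹ ^ (n + 1) := pow_le_pow_left₀ hξ0.le i5 _
        have i7 : 1 ≤ ‖((Real.fourierChar (inner ℝ h ξ) : Circle) : ℂ) - 1‖ ^ 2 := by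
          rw [norm_char_sub_one, mul_pow, sq_abs]
          set t := inner ℝ h ξ
          have : Real.cos (2 * (Real.pi * t)) ≤ 0 :=
            Real.cos_nonpos_of_pi_div_two_le_of_le (by nlinarith) (by nlinarith)
          rw [Real.cos_two_mul, Real.cos_sq'] at this
          nlinarith
        have : 0 ≤ ‖h‖⁻¹ ^ (n + 1) := by positivity
        nlinarith

/-- Squared homogeneous Sobolev norm of order one half. -/
def LL {n : ℕ} (f : En n → ℂ) : ENNReal := ∫⁻ ξ, ENNReal.ofReal (‖ξ‖ * ‖𝓕 f ξ‖ ^ 2)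

lemma four_meas {n : ℕ} (f : SchwartzMap (En n) ℂ) : Measurable (𝓕 (f : En n → ℂ)) := by
  rw [← SchwartzMap.fourier_coe]; exact (𝓕 f).continuous.measurable

lemma GG_le_LL {n : ℕ} (hn : 2 ≤ n) (f : SchwartzMap (En n) ℂ) :
    GG f ≤ 4 * ENNReal.ofReal Real.pi * JJ n * LL f := by
  have := four_meas f
  rw [GG_fourier, LL, ← lintegral_const_mul _ (by fun_prop)]
  apply lintegral_mono_ae
  filter_upwards [ae_ne_zero hn] with ξ hξ
  rw [ENNReal.ofReal_mul (norm_nonneg _), ← mul_assoc]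
  gcongr
  exact cc_le hξ

lemma LL_le_GG {n : ℕ} (hn : 2 ≤ n) (f : SchwartzMap (En n) ℂ) :
    ENNReal.ofReal ((1 / 4) ^ n) * volume (Metric.ball (0 : En n) 1) * LL f ≤ GG f := by
  have := four_meas f
  rw [GG_fourier, LL, ← lintegral_const_mul _ (by fun_prop)]
  apply lintegral_mono_ae
  filter_upwards [ae_ne_zero hn] with ξ hξ
  rw [ENNReal.ofReal_mul (norm_nonneg _), ← mul_assoc]
  gcongr
  exact le_cc hξ

open scoped LineDeriv

lemma pairing {n : ℕ} (g f : SchwartzMap (En n) ℂ) (j : Fin n) :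
    ‖∫ x, starRingEnd ℂ (g x) * pd j f x‖ₑ ≤ ENNReal.ofReal Real.pi * (LL g + LL f) := by
  have hg := four_meas g
  have hf := four_meas f
  have hpi := Real.pi_pos
  have h1 := SchwartzMap.integral_inner_fourier_fourier g
    (∂_{(EuclideanSpace.single j 1 : En n)} f)
  have h2 : ∫ x, starRingEnd ℂ (g x) * pd j f x
      = ∫ x, inner ℂ (g x) ((∂_{(EuclideanSpace.single j 1 : En n)} f) x) := by
    congr 1
    ext x
    rw [RCLike.inner_apply, mul_comm, SchwartzMap.lineDerivOp_apply_eq_fderiv]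
    rfl
  rw [h2, ← h1]
  refine (enorm_integral_le_lintegral_enorm _).trans ?_
  unfold LL
  rw [← lintegral_add_left (by fun_prop), ← lintegral_const_mul _ (by fun_prop)]
  apply lintegral_mono
  intro ξ
  dsimp only
  rw [← ENNReal.ofReal_add (by positivity) (by positivity), ← ENNReal.ofReal_mul hpi.le,
    ← ofReal_norm_eq_enorm]
  apply ENNReal.ofReal_le_ofReal
  refine (norm_inner_le_norm _ _).trans ?_
  have h3 : ‖(𝓕 (∂_{(EuclideanSpace.single j 1 : En n)} f)) ξ‖
      ≤ 2 * Real.pi * ‖ξ‖ * ‖𝓕 (f : En n → ℂ) ξ‖ := by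
    have ht : (fun x : En n => inner ℝ x (EuclideanSpace.single j 1 : En n)).HasTemperateGrowth := by
      fun_prop
    rw [SchwartzMap.fourier_lineDerivOp_eq, SchwartzMap.smul_apply,
      SchwartzMap.smulLeftCLM_apply_apply ht, norm_smul, norm_smul, SchwartzMap.fourier_coe]
    have e1 : ‖(2 * Real.pi * Complex.I : ℂ)‖ = 2 * Real.pi := by
      simp [abs_of_pos hpi]
    have e2 : ‖inner ℝ ξ (EuclideanSpace.single j 1 : En n)‖ ≤ ‖ξ‖ := by
      refine (norm_inner_le_norm _ _).trans ?_
      simp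
    rw [e1, ← mul_assoc]
    gcongr
  rw [SchwartzMap.fourier_coe g]
  have h4 := mul_le_mul_of_nonneg_left h3 (norm_nonneg (𝓕 (g : En n → ℂ) ξ))
  refine h4.trans ?_
  have h5 : 0 ≤ Real.pi * ‖ξ‖ := by positivity
  nlinarith [mul_nonneg h5 (sq_nonneg (‖𝓕 (g : En n → ℂ) ξ‖ - ‖𝓕 (f : En n → ℂ) ξ‖))]

lemma main_smooth {n : ℕ} (hn : 2 ≤ n) :
    ∃ C : ENNReal, C ≠ ⊤ ∧ ∀ (f : SchwartzMap (En n) ℂ) (b : En n → ℝ) (j : Fin n),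
      b.HasTemperateGrowth → (∀ x, |b x| ≤ 1) →
      (∀ x h, x ≠ 0 → |b (x + h) - b x| ≤ 2 * min 1 (‖x‖⁻¹ * ‖h‖)) →
      ‖∫ x, (b x : ℂ) * (starRingEnd ℂ (f x) * pd j f x)‖ₑ ≤ C * LL f := by
  obtain ⟨C₁, hC₁, H⟩ := hardy hn
  have hJ := (JJ_lt_top n hn).ne
  set c := ENNReal.ofReal ((1 / 4) ^ n) * volume (Metric.ball (0 : En n) 1) with hc
  have hc0 : c ≠ 0 := by
    apply mul_ne_zero _ (Metric.measure_ball_pos volume 0 one_pos).ne'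
    rw [Ne, ENNReal.ofReal_eq_zero, not_le]; positivity
  have hct : c ≠ ⊤ := ENNReal.mul_ne_top ENNReal.ofReal_ne_top measure_ball_lt_top.ne
  set D := c⁻¹ * ((2 + 8 * JJ n * C₁) * (4 * ENNReal.ofReal Real.pi * JJ n)) with hD
  have hDt : D ≠ ⊤ := by
    have hp := ENNReal.ofReal_ne_top (r := Real.pi)
    have hci := ENNReal.inv_ne_top.2 hc0
    rw [hD]
    finiteness
  refine ⟨ENNReal.ofReal Real.pi * (D + 1), by finiteness, ?_⟩
  intro f b j hb hb1 hb2
  set g : SchwartzMap (En n) ℂ := SchwartzMap.smulLeftCLM ℂ b f with hg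
  have hgx : ∀ x, g x = (b x : ℂ) * f x := by
    intro x
    rw [hg, SchwartzMap.smulLeftCLM_apply_apply hb, Complex.real_smul]
  have hgf : (g : En n → ℂ) = fun x => (b x : ℂ) * f x := funext hgx
  have h1 : GG g ≤ (2 + 8 * JJ n * C₁) * GG f := by
    rw [hgf]
    refine (GG_prod hn f f.continuous b hb1 hb2).trans ?_
    calc _ ≤ 2 * GG f + 8 * JJ n * (C₁ * GG f) := by gcongr; exact H f
      _ = _ := by ring
  have h2 : LL g ≤ D * LL f := by
    calc LL g = c⁻¹ * (c * LL g) := by rw [← mul_assoc, ENNReal.inv_mul_cancel hc0 hct, one_mul]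
      _ ≤ c⁻¹ * GG g := by gcongr; exact LL_le_GG hn g
      _ ≤ c⁻¹ * ((2 + 8 * JJ n * C₁) * (4 * ENNReal.ofReal Real.pi * JJ n * LL f)) := by
          gcongr
          refine h1.trans ?_
          gcongr
          exact GG_le_LL hn f
      _ = _ := by rw [hD]; ring
  have h3 := pairing g f j
  have h4 : ∫ x, (b x : ℂ) * (starRingEnd ℂ (f x) * pd j f x)
      = ∫ x, starRingEnd ℂ (g x) * pd j f x := by
    congr 1
    ext x
    rw [hgx, map_mul, Complex.conj_ofReal, mul_assoc]
  rw [h4]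
  refine h3.trans ?_
  rw [mul_assoc, add_mul, one_mul]
  gcongr

/-- Regularized unit vector component. -/
def theta {n : ℕ} (j : Fin n) (z : En n) : ℝ := z j * (1 + ‖z‖ ^ 2) ^ (-(1 / 2) : ℝ)

lemma theta_eq {n : ℕ} (j : Fin n) (z : En n) : theta j z = z j / √(1 + ‖z‖ ^ 2) := by
  unfold theta
  rw [Real.rpow_neg (by positivity), ← Real.sqrt_eq_rpow, div_eq_mul_inv]

lemma abs_coord_le {n : ℕ} (j : Fin n) (z : En n) : |z j| ≤ ‖z‖ := by
  simpa using PiLp.norm_apply_le z j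

lemma norm_le_sqrt {n : ℕ} (z : En n) : ‖z‖ ≤ √(1 + ‖z‖ ^ 2) :=
  Real.le_sqrt_of_sq_le (by linarith)

lemma theta_abs {n : ℕ} (j : Fin n) (z : En n) : |theta j z| ≤ 1 := by
  have h : 0 < √(1 + ‖z‖ ^ 2) := by positivity
  rw [theta_eq, abs_div, abs_of_pos h, div_le_one h]
  exact (abs_coord_le j z).trans (norm_le_sqrt z)

lemma sqrt_add_le {n : ℕ} (z w : En n) : √(1 + ‖z + w‖ ^ 2) ≤ √(1 + ‖z‖ ^ 2) + ‖w‖ := by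
  apply Real.sqrt_le_iff.2 ⟨by positivity, ?_⟩
  have h1 := Real.sq_sqrt (show 0 ≤ 1 + ‖z‖ ^ 2 by positivity)
  have h2 := norm_le_sqrt z
  have h3 := norm_add_le z w
  have h4 : ‖z + w‖ ^ 2 ≤ (‖z‖ + ‖w‖) ^ 2 := pow_le_pow_left₀ (norm_nonneg _) h3 2
  nlinarith [mul_le_mul_of_nonneg_right h2 (norm_nonneg w)]

lemma theta_diff {n : ℕ} (j : Fin n) (z w : En n) (hz : z ≠ 0) :
    |theta j (z + w) - theta j z| ≤ 2 * min 1 (‖z‖⁻¹ * ‖w‖) := by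
  rw [mul_min_of_nonneg _ _ (by norm_num)]
  have hz0 : 0 < ‖z‖ := by positivity
  apply le_min
  · have h1 := theta_abs j (z + w)
    have h2 := theta_abs j z
    have := abs_sub (theta j (z + w)) (theta j z)
    linarith
  · have ha := sqrt_add_le z w
    have hb := sqrt_add_le (z + w) (-w)
    rw [add_neg_cancel_right, norm_neg] at hb
    have hs : 0 < √(1 + ‖z‖ ^ 2) := by positivity
    have hs' : 0 < √(1 + ‖z + w‖ ^ 2) := by positivity
    have hzs := norm_le_sqrt z
    have ht := theta_abs j (z + w)
    have e1 : theta j (z + w) - theta j z = (w j + theta j (z + w) *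
        (√(1 + ‖z‖ ^ 2) - √(1 + ‖z + w‖ ^ 2))) / √(1 + ‖z‖ ^ 2) := by
      rw [theta_eq, theta_eq]
      simp only [PiLp.add_apply]
      field_simp
      ring
    set s := √(1 + ‖z‖ ^ 2)
    set s' := √(1 + ‖z + w‖ ^ 2)
    have e2 : |w j + theta j (z + w) * (s - s')| ≤ 2 * ‖w‖ := by
      have a1 := abs_add_le (w j) (theta j (z + w) * (s - s'))
      have a2 := abs_coord_le j w
      have a3 : |s - s'| ≤ ‖w‖ := by rw [abs_le]; constructor <;> linarith
      have a4 : |theta j (z + w) * (s - s')| ≤ 1 * ‖w‖ := by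
        rw [abs_mul]
        exact mul_le_mul ht a3 (abs_nonneg _) (by norm_num)
      linarith
    rw [e1, abs_div, abs_of_pos hs]
    calc _ ≤ 2 * ‖w‖ / ‖z‖ := by gcongr
      _ = _ := by rw [div_eq_mul_inv]; ring

lemma theta_lim {n : ℕ} (j : Fin n) (x : En n) :
    Filter.Tendsto (fun m : ℕ => theta j (((m : ℝ) + 1) • x)) Filter.atTop
      (nhds (x j / ‖x‖)) := by
  rcases eq_or_ne x 0 with rfl | hx
  · simp [theta_eq]
  have hx0 : 0 < ‖x‖ := by positivity
  have e : ∀ m : ℕ, theta j (((m : ℝ) + 1) • x)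
      = x j / √((1 / ((m : ℝ) + 1)) ^ 2 + ‖x‖ ^ 2) := by
    intro m
    have hm : 0 < (m : ℝ) + 1 := by positivity
    rw [theta_eq, norm_smul, Real.norm_of_nonneg hm.le]
    have : 1 + (((m : ℝ) + 1) * ‖x‖) ^ 2
        = ((m : ℝ) + 1) ^ 2 * ((1 / ((m : ℝ) + 1)) ^ 2 + ‖x‖ ^ 2) := by
      field_simp
    rw [this, Real.sqrt_mul (by positivity), Real.sqrt_sq hm.le]
    simp only [PiLp.smul_apply, smul_eq_mul]
    rw [mul_div_mul_left _ _ hm.ne']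
  simp_rw [e]
  have h1 := tendsto_one_div_add_atTop_nhds_zero_nat (𝕜 := ℝ)
  have h2 : Filter.Tendsto (fun m : ℕ => √((1 / ((m : ℝ) + 1)) ^ 2 + ‖x‖ ^ 2)) Filter.atTop
      (nhds ‖x‖) := by
    have := ((h1.pow 2).add_const (‖x‖ ^ 2)).sqrt
    simpa using this
  exact tendsto_const_nhds.div h2 hx0.ne'

lemma theta_temperate {n : ℕ} (j : Fin n) (k : ℝ) :
    (fun x : En n => theta j (k • x)).HasTemperateGrowth := by
  have h1 : (fun z : En n => theta j z).HasTemperateGrowth := by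
    unfold theta
    apply Function.HasTemperateGrowth.mul
    · exact (EuclideanSpace.proj (𝕜 := ℝ) j : En n →L[ℝ] ℝ).hasTemperateGrowth
    · exact Function.hasTemperateGrowth_one_add_norm_sq_rpow (En n) _
  exact h1.comp (k • ContinuousLinearMap.id ℝ (En n)).hasTemperateGrowth

lemma dens_integrable {n : ℕ} (f : SchwartzMap (En n) ℂ) (j : Fin n) :
    Integrable (fun x => starRingEnd ℂ (f x) * pd j f x) := by
  obtain ⟨B, hB0, hB⟩ : ∃ B : ℝ, 0 ≤ B ∧ ∀ x, ‖f x‖ ≤ B := by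
    obtain ⟨B, hB⟩ := f.decay 0 0
    exact ⟨B, hB.1.le, fun x => by simpa using hB.2 x⟩
  have h1 : Integrable (fun x => pd j f x) :=
    (∂_{(EuclideanSpace.single j 1 : En n)} f).integrable
  refine h1.bdd_mul (c := B) ?_ ?_
  · exact (Complex.continuous_conj.comp f.continuous).aestronglyMeasurable
  · exact .of_forall fun x => by simpa using hB x

lemma main_lim {n : ℕ} (hn : 2 ≤ n) :
    ∃ C : ENNReal, C ≠ ⊤ ∧ ∀ (f : SchwartzMap (En n) ℂ) (j : Fin n),
      ‖∫ x, ((x j / ‖x‖ : ℝ) : ℂ) * (starRingEnd ℂ (f x) * pd j f x)‖ₑ ≤ C * LL f := by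
  obtain ⟨C, hC, H⟩ := main_smooth hn
  refine ⟨C, hC, fun f j => ?_⟩
  have hb : ∀ m : ℕ, ‖∫ x, (theta j (((m : ℝ) + 1) • x) : ℂ)
      * (starRingEnd ℂ (f x) * pd j f x)‖ₑ ≤ C * LL f := by
    intro m
    have hm : 0 < (m : ℝ) + 1 := by positivity
    refine H f (fun x => theta j (((m : ℝ) + 1) • x)) j (theta_temperate j _)
      (fun x => theta_abs j _) ?_
    intro x h hx
    have := theta_diff j (((m : ℝ) + 1) • x) (((m : ℝ) + 1) • h) (smul_ne_zero hm.ne' hx)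
    rw [smul_add]
    refine this.trans (le_of_eq ?_)
    rw [norm_smul, norm_smul, Real.norm_of_nonneg hm.le]
    congr 2
    field_simp
  have hlim : Filter.Tendsto (fun m : ℕ => ∫ x, (theta j (((m : ℝ) + 1) • x) : ℂ)
      * (starRingEnd ℂ (f x) * pd j f x)) Filter.atTop
      (nhds (∫ x, ((x j / ‖x‖ : ℝ) : ℂ) * (starRingEnd ℂ (f x) * pd j f x))) := by
    have hd := dens_integrable f j
    refine tendsto_integral_of_dominated_convergence
      (fun x => ‖starRingEnd ℂ (f x) * pd j f x‖) ?_ hd.norm ?_ ?_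
    · intro m
      refine AEStronglyMeasurable.mul ?_ hd.1
      have hc := (theta_temperate (n := n) j ((m : ℝ) + 1)).1.continuous
      exact (Complex.continuous_ofReal.comp hc).aestronglyMeasurable
    · intro m
      refine .of_forall fun x => ?_
      rw [norm_mul, Complex.norm_real, Real.norm_eq_abs]
      exact mul_le_of_le_one_left (norm_nonneg _) (theta_abs j _)
    · refine .of_forall fun x => ?_
      exact ((Complex.continuous_ofReal.tendsto _).comp (theta_lim j x)).mul_const _
  exact le_of_tendsto hlim.enorm (.of_forall hb)

lemma unit_dens_integrable {n : ℕ} (f : SchwartzMap (En n) ℂ) (j : Fin n) :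
    Integrable (fun x : En n => ((x j / ‖x‖ : ℝ) : ℂ) * (starRingEnd ℂ (f x) * pd j f x)) := by
  refine (dens_integrable f j).bdd_mul (c := 1) ?_ ?_
  · apply Measurable.aestronglyMeasurable
    fun_prop
  · refine .of_forall fun x => ?_
    rw [Complex.norm_real, Real.norm_eq_abs, abs_div, abs_norm]
    exact div_le_one_of_le₀ (abs_coord_le j x) (norm_nonneg _)

lemma LL_eq {n : ℕ} (f : SchwartzMap (En n) ℂ) :
    LL f = ENNReal.ofReal (∫ ξ, ‖ξ‖ * ‖𝓕 (f : En n → ℂ) ξ‖ ^ 2) := by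
  have hi : Integrable (fun ξ => ‖ξ‖ * ‖𝓕 (f : En n → ℂ) ξ‖ ^ 2) := by
    rw [← SchwartzMap.fourier_coe]
    set g := 𝓕 f
    obtain ⟨B, hB0, hB⟩ : ∃ B : ℝ, 0 ≤ B ∧ ∀ x, ‖g x‖ ≤ B := by
      obtain ⟨B, hB⟩ := g.decay 0 0
      exact ⟨B, hB.1.le, fun x => by simpa using hB.2 x⟩
    have h1 := (g.integrable_pow_mul volume 1).bdd_mul (c := B)
      (f := fun x => ‖g x‖) g.continuous.norm.aestronglyMeasurable
      (.of_forall fun x => by simpa using hB x)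
    refine h1.congr (.of_forall fun x => ?_)
    simp only [pow_one]
    ring
  rw [ofReal_integral_eq_lintegral_ofReal hi (.of_forall fun x => by positivity)]
  rfl

/-- Hardy-type bound for the Morawetz action:
`|M_y(t)| ≤ C ‖u(t)‖²_{Ḣ^{1/2}}`. -/
theorem statement_9 (n : ℕ) (hn : 2 ≤ n) :
    ∃ C : ℝ, 0 < C ∧
      ∀ (p lam : ℝ), 1 < p →
        ∀ u : ℝ → En n → ℂ, NLSSolution n p lam u →
          ∀ (t : ℝ) (y : En n),
            |morAction u y t| ≤ C * ∫ ξ : En n, ‖ξ‖ * ‖𝓕 (u t) ξ‖ ^ 2 := by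
  obtain ⟨C, hC, H⟩ := main_lim hn
  refine ⟨n * C.toReal + 1, by positivity, ?_⟩
  intro p lam _ u hu t y
  let f₀ : SchwartzMap (En n) ℂ :=
    { toFun := u t
      smooth' := hu.smooth.comp (contDiff_const.prodMk contDiff_id)
      decay' := fun k m => by
        obtain ⟨B, hB⟩ := hu.decay m k |t|
        exact ⟨B, fun x => hB t le_rfl x⟩ }
  let f : SchwartzMap (En n) ℂ := f₀.compSubConstCLM ℂ (-y)
  have hf : (f : En n → ℂ) = fun x => u t (x + y) := by
    ext x
    change u t (x - -y) = _
    rw [sub_neg_eq_add]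
  have hfour : ∀ ξ, ‖𝓕 (f : En n → ℂ) ξ‖ = ‖𝓕 (u t) ξ‖ := by
    intro ξ
    rw [hf, fourier_shift, norm_mul, Circle.norm_coe, one_mul]
  set L := ∫ ξ : En n, ‖ξ‖ * ‖𝓕 (u t) ξ‖ ^ 2 with hL
  have hL0 : 0 ≤ L := integral_nonneg fun ξ => by positivity
  have hLL : LL f = ENNReal.ofReal L := by
    rw [LL_eq, hL]
    simp_rw [hfour]
  have hpd : ∀ j x, pd j f x = pd j (u t) (x + y) := by
    intro j x
    unfold pd
    rw [hf, fderiv_comp_add_right]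
  have hM : morAction u y t = ∑ j, (∫ x : En n, ((x j / ‖x‖ : ℝ) : ℂ)
      * (starRingEnd ℂ (f x) * pd j f x)).im := by
    unfold morAction
    rw [← integral_add_right_eq_self _ y]
    have : ∀ j, (∫ x : En n, ((x j / ‖x‖ : ℝ) : ℂ) * (starRingEnd ℂ (f x) * pd j f x)).im
        = ∫ x : En n, (x j / ‖x‖) * mom u j t (x + y) := by
      intro j
      have h1 := Complex.imCLM.integral_comp_comm (unit_dens_integrable f j)
      rw [Complex.imCLM_apply] at h1
      rw [← h1]
      congr 1
      ext x
      rw [Complex.imCLM_apply, Complex.im_ofReal_mul, hpd, hf]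
      rfl
    simp_rw [this]
    rw [integral_finset_sum]
    · simp
    · intro j _
      have h1 := (unit_dens_integrable f j).im
      refine h1.congr (.of_forall fun x => ?_)
      change (((x j / ‖x‖ : ℝ) : ℂ) * (starRingEnd ℂ (f x) * pd j f x)).im = _
      rw [Complex.im_ofReal_mul, hpd, hf]
      simp [mom]
  have hj : ∀ j, |(∫ x : En n, ((x j / ‖x‖ : ℝ) : ℂ)
      * (starRingEnd ℂ (f x) * pd j f x)).im| ≤ C.toReal * L := by
    intro j
    refine (Complex.abs_im_le_norm _).trans ?_
    have h1 := H f j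
    rw [hLL, ← ENNReal.ofReal_toReal hC, ← ENNReal.ofReal_mul ENNReal.toReal_nonneg,
      ← ofReal_norm_eq_enorm, ENNReal.ofReal_le_ofReal_iff
        (mul_nonneg ENNReal.toReal_nonneg hL0)] at h1
    exact h1
  rw [hM]
  calc _ ≤ ∑ j : Fin n, C.toReal * L :=
        (Finset.abs_sum_le_sum_abs _ _).trans (Finset.sum_le_sum fun j _ => hj j)
    _ = n * C.toReal * L := by simp; ring
    _ ≤ _ := by nlinarith
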